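/- arXiv:2603.01939 — 5 statements merged into one kernel-verified Lean document; each statement's English description precedes it below -/
import Mathlib

section
/- Let K ∈ ℕ and c₀, c > 0. There exist constants C > 0 and c′ > 0, depending only on K, c₀ and c, with the following property. For every ε ∈ (0, 1/2] and every family of continuous nonnegative functions E₀, …, E_K : [0,∞) → ℝ satisfying, for every k ∈ {0, …, K} and every t ≥ 0, the recursive inequality E_k(t) ≤ ε·(1+t)^{c₀ε} + ε·E_k(0) + ∫₀ᵗ ε·(1+τ)^{cε−1}·E_{k−1}(τ) dτ + ∫₀ᵗ (ε/(1+τ))·E_k(τ) dτ (with the convention that the term involving E_{k−1} is absent when k = 0), one has E_k(t) ≤ C·ε·(1+t)^{c′ε} for every k ∈ {0, …, K} and every t ≥ 0. -/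
lemma rgs_gronwall (ε A b : ℝ) (hε : 0 < ε) (hA : 0 ≤ A) (hb : 2 ≤ b) (E : ℝ → ℝ)
    (hE : ContinuousOn E (Set.Ici (0 : ℝ)))
    (h : ∀ t : ℝ, 0 ≤ t → E t ≤ A * (1 + t) ^ (b * ε) + ∫ τ in (0 : ℝ)..t, (ε / (1 + τ)) * E τ)
    (T : ℝ) (hT : 0 ≤ T) : E T ≤ 2 * A * (1 + T) ^ (b * ε) := by
  set f : ℝ → ℝ := fun τ => (ε / (1 + τ)) * E τ with hf
  have hfc : ContinuousOn f (Set.Ici (0 : ℝ)) := by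
    refine ContinuousOn.mul (ContinuousOn.div continuousOn_const (by fun_prop) ?_) hE
    intro x hx
    have : (0 : ℝ) ≤ x := hx
    positivity
  have hint : ∀ t : ℝ, 0 ≤ t → IntervalIntegrable f MeasureTheory.volume 0 t := by
    intro t ht
    apply ContinuousOn.intervalIntegrable
    rw [Set.uIcc_of_le ht]
    exact hfc.mono Set.Icc_subset_Ici_self
  have hFd : ∀ t : ℝ, 0 < t → HasDerivAt (fun t => ∫ τ in (0 : ℝ)..t, f τ) (f t) t := by
    intro t ht
    have hc' : ContinuousOn f (Set.Ioi (0 : ℝ)) := hfc.mono Set.Ioi_subset_Ici_self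
    exact intervalIntegral.integral_hasDerivAt_right (hint t ht.le)
      (hc'.stronglyMeasurableAtFilter isOpen_Ioi t ht) (hc'.continuousAt (Ioi_mem_nhds ht))
  have hFc : ContinuousOn (fun t => ∫ τ in (0 : ℝ)..t, f τ) (Set.Icc 0 T) := by
    have := intervalIntegral.continuousOn_primitive_interval' (hint T hT) (Set.left_mem_uIcc)
    rwa [Set.uIcc_of_le hT] at this
  have hpc : ∀ p : ℝ, ContinuousOn (fun t : ℝ => (1 + t) ^ p) (Set.Icc 0 T) := by
    intro p
    refine ContinuousOn.rpow_const (by fun_prop) ?_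
    intro x hx
    left
    have := hx.1
    positivity
  have hpd : ∀ p t : ℝ, 0 < t → HasDerivAt (fun t : ℝ => (1 + t) ^ p) (p * (1 + t) ^ (p - 1)) t := by
    intro p t ht
    have := ((hasDerivAt_id t).const_add 1).rpow_const (p := p) (Or.inl (by simp only [id]; positivity))
    simpa using this
  have hanti : AntitoneOn (fun t : ℝ => (1 + t) ^ (-ε) * (∫ τ in (0 : ℝ)..t, f τ)
      - A * (1 + t) ^ ((b - 1) * ε)) (Set.Icc 0 T) := by
    have hd : ∀ t : ℝ, 0 < t → HasDerivAt (fun t : ℝ => (1 + t) ^ (-ε) * (∫ τ in (0 : ℝ)..t, f τ)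
      - A * (1 + t) ^ ((b - 1) * ε)) _ t := fun t ht =>
        ((hpd (-ε) t ht).mul (hFd t ht)).sub ((hpd ((b - 1) * ε) t ht).const_mul A)
    apply antitoneOn_of_deriv_nonpos (convex_Icc 0 T)
    · exact ((hpc _).mul hFc).sub (continuousOn_const.mul (hpc _))
    · intro t ht
      rw [interior_Icc] at ht
      exact (hd t ht.1).differentiableAt.differentiableWithinAt
    · intro t ht
      rw [interior_Icc] at ht
      have ht0 := ht.1
      rw [(hd t ht0).deriv]
      have h1 : 0 < 1 + t := by positivity
      have e1 : (1 + t) ^ (-ε) = (1 + t) ^ (-ε - 1) * (1 + t) := by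
        rw [Real.rpow_sub_one h1.ne']; field_simp
      have e2 : (1 + t) ^ ((b - 1) * ε - 1) = (1 + t) ^ (-ε - 1) * (1 + t) ^ (b * ε) := by
        rw [← Real.rpow_add h1]; ring_nf
      have hq : 0 < (1 + t) ^ (-ε - 1) := by positivity
      have hr : 0 < (1 + t) ^ (b * ε) := by positivity
      have hh := h t ht0.le
      rw [e2, e1]
      have e3 : f t * (1 + t) = ε * E t := by simp only [hf]; field_simp
      set F := ∫ τ in (0 : ℝ)..t, f τ
      have : E t - F - A * (b - 1) * (1 + t) ^ (b * ε) ≤ 0 := by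
        have : 0 ≤ A * (1 + t) ^ (b * ε) * (b - 2) :=
          mul_nonneg (by positivity) (by linarith)
        linarith
      have := mul_nonpos_of_nonneg_of_nonpos (mul_pos hε hq).le this
      linear_combination this + (1 + t) ^ (-ε - 1) * e3
  have h0 := hanti (Set.left_mem_Icc.2 hT) (Set.right_mem_Icc.2 hT) hT
  simp only [intervalIntegral.integral_same, add_zero, Real.one_rpow] at h0
  have h1 : 0 < 1 + T := by positivity
  have hh := h T hT
  have e : (1 + T) ^ ((b - 1) * ε) = (1 + T) ^ (-ε) * (1 + T) ^ (b * ε) := by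
    rw [← Real.rpow_add h1]; ring_nf
  have hq : 0 < (1 + T) ^ (-ε) := by positivity
  rw [e] at h0
  have : (∫ τ in (0 : ℝ)..T, f τ) ≤ A * (1 + T) ^ (b * ε) := by
    refine le_of_mul_le_mul_left ?_ hq
    linarith
  linarith

lemma rgs_int (ε c a C : ℝ) (hε : 0 < ε) (hc : 0 < c) (ha : 1 ≤ a) (hC : 0 ≤ C) (E : ℝ → ℝ)
    (hE : ContinuousOn E (Set.Ici (0 : ℝ)))
    (h : ∀ t : ℝ, 0 ≤ t → E t ≤ C * ε * (1 + t) ^ (a * ε)) (t : ℝ) (ht : 0 ≤ t) :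
    (∫ τ in (0 : ℝ)..t, ε * (1 + τ) ^ (c * ε - 1) * E τ) ≤ C * ε * (1 + t) ^ ((a + c) * ε) := by
  have hpc : ∀ p : ℝ, ContinuousOn (fun t : ℝ => (1 + t) ^ p) (Set.Icc 0 t) := by
    intro p
    refine ContinuousOn.rpow_const (by fun_prop) ?_
    intro x hx
    left
    have := hx.1
    positivity
  have hi2 : IntervalIntegrable (fun τ : ℝ => C * ε * ((a + c) * ε * (1 + τ) ^ ((a + c) * ε - 1)))
      MeasureTheory.volume 0 t := by
    apply ContinuousOn.intervalIntegrable
    rw [Set.uIcc_of_le ht]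
    exact continuousOn_const.mul (continuousOn_const.mul (hpc _))
  have hi1 : IntervalIntegrable (fun τ : ℝ => ε * (1 + τ) ^ (c * ε - 1) * E τ)
      MeasureTheory.volume 0 t := by
    apply ContinuousOn.intervalIntegrable
    rw [Set.uIcc_of_le ht]
    exact (continuousOn_const.mul (hpc _)).mul (hE.mono Set.Icc_subset_Ici_self)
  have hle := intervalIntegral.integral_mono_on ht hi1 hi2 (by
    intro x hx
    have hx0 := hx.1
    have h1 : 0 < 1 + x := by positivity
    have e : (1 + x) ^ ((a + c) * ε - 1) = (1 + x) ^ (c * ε - 1) * (1 + x) ^ (a * ε) := by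
      rw [← Real.rpow_add h1]; ring_nf
    have hq : 0 < (1 + x) ^ (c * ε - 1) := by positivity
    have hr : 0 < (1 + x) ^ (a * ε) := by positivity
    rw [e]
    have k1 := mul_le_mul_of_nonneg_left (h x hx0) (mul_pos hε hq).le
    have k2 : 0 ≤ C * ε * (ε * (1 + x) ^ (c * ε - 1) * (1 + x) ^ (a * ε)) * (a + c - 1) :=
      mul_nonneg (by positivity) (by linarith)
    linarith)
  rw [intervalIntegral.integral_eq_sub_of_hasDerivAt
    (f := fun τ : ℝ => C * ε * (1 + τ) ^ ((a + c) * ε)) ?_ hi2] at hle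
  · simp only [add_zero, Real.one_rpow] at hle
    have : 0 ≤ C * ε := by positivity
    linarith
  · intro x hx
    rw [Set.uIcc_of_le ht] at hx
    have hx0 := hx.1
    have := ((hasDerivAt_id x).const_add 1).rpow_const (p := (a + c) * ε)
      (Or.inl (by simp only [id]; positivity))
    simpa using this.const_mul (C * ε)

lemma rgs_zero (ε x : ℝ) (hε : 0 < ε) (hε2 : ε ≤ 1 / 2) (hx : 0 ≤ x) (h : x ≤ ε + ε * x) :
    ε * x ≤ ε := by
  have : x ≤ 1 := by nlinarith
  nlinarith

lemma rgs_main (K : ℕ) (c₀ c : ℝ) (hc₀ : 0 < c₀) (hc : 0 < c) :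
    ∃ C > (0 : ℝ), ∃ c' ≥ c₀ + 2,
      ∀ ε : ℝ, 0 < ε → ε ≤ 1 / 2 →
      ∀ E : ℕ → ℝ → ℝ,
        (∀ k ≤ K, ContinuousOn (E k) (Set.Ici (0 : ℝ))) →
        (∀ k ≤ K, ∀ t : ℝ, 0 ≤ t → 0 ≤ E k t) →
        (∀ k ≤ K, ∀ t : ℝ, 0 ≤ t →
          E k t ≤ ε * (1 + t) ^ (c₀ * ε) + ε * E k 0
            + (if k = 0 then 0 else
                ∫ τ in (0 : ℝ)..t, ε * (1 + τ) ^ (c * ε - 1) * E (k - 1) τ)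
            + ∫ τ in (0 : ℝ)..t, (ε / (1 + τ)) * E k τ) →
        ∀ k ≤ K, ∀ t : ℝ, 0 ≤ t → E k t ≤ C * ε * (1 + t) ^ (c' * ε) := by
  have base : ∀ ε : ℝ, 0 < ε → ∀ b ≥ c₀, ∀ t : ℝ, 0 ≤ t →
      ε * (1 + t) ^ (c₀ * ε) + ε ≤ 2 * ε * (1 + t) ^ (b * ε) := by
    intro ε hε b hb t ht
    have h1 : (1 + t) ^ (c₀ * ε) ≤ (1 + t) ^ (b * ε) :=
      Real.rpow_le_rpow_of_exponent_le (by linarith) (by gcongr)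
    have h2 : 1 ≤ (1 + t) ^ (b * ε) :=
      Real.one_le_rpow (by linarith) (mul_nonneg (by linarith) hε.le)
    nlinarith
  induction K with
  | zero =>
    refine ⟨4, by norm_num, c₀ + 2, le_rfl, ?_⟩
    intro ε hε hε2 E hEc hE0 hE k hk t ht
    obtain rfl : k = 0 := by omega
    have z : ε * E 0 0 ≤ ε := rgs_zero ε _ hε hε2 (hE0 0 hk 0 le_rfl)
      (by simpa using hE 0 hk 0 le_rfl)
    have := rgs_gronwall ε (2 * ε) (c₀ + 2) hε (by positivity) (by linarith) (E 0) (hEc 0 hk)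
      (fun t ht => by
        have h1 := hE 0 hk t ht
        have h2 := base ε hε (c₀ + 2) (by linarith) t ht
        simp only [if_true] at h1
        linarith) t ht
    linarith
  | succ K ih =>
    obtain ⟨C, hC, a, ha, ih⟩ := ih
    refine ⟨2 * (2 + C), by positivity, a + c, by linarith, ?_⟩
    intro ε hε hε2 E hEc hE0 hE k hk t ht
    have ih' := ih ε hε hε2 E (fun k hk => hEc k (by omega)) (fun k hk => hE0 k (by omega))
      (fun k hk => hE k (by omega))
    rcases Nat.lt_or_ge K k with hlt | hge
    · obtain rfl : k = K + 1 := by omega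
      have z : ε * E (K + 1) 0 ≤ ε := rgs_zero ε _ hε hε2 (hE0 _ hk 0 le_rfl)
        (by simpa using hE _ hk 0 le_rfl)
      have := rgs_gronwall ε ((2 + C) * ε) (a + c) hε (by positivity) (by linarith) (E (K + 1))
        (hEc _ hk) (fun t ht => by
          have h1 := hE _ hk t ht
          have h2 := base ε hε (a + c) (by linarith) t ht
          have h3 := rgs_int ε c a C hε hc (by linarith) hC.le (E K) (hEc K (by omega))
            (ih' K le_rfl) t ht
          simp only [Nat.succ_ne_zero, if_false, Nat.add_sub_cancel] at h1
          linarith) t ht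
      linarith
    · refine (ih' k hge t ht).trans ?_
      have : (1 + t) ^ (a * ε) ≤ (1 + t) ^ ((a + c) * ε) :=
        Real.rpow_le_rpow_of_exponent_le (by linarith) (by gcongr; linarith)
      gcongr
      linarith

/-- **Recursive scheme of Grönwall-type inequalities.**
Let `K ∈ ℕ` and `c₀, c > 0`.  There exist constants `C > 0` and `c′ > 0`, depending only
on `K`, `c₀` and `c`, such that for every `ε ∈ (0, 1/2]` and every family of continuous
nonnegative functions `E 0, …, E K : [0,∞) → ℝ` satisfying, for every `k ∈ {0,…,K}` and
every `t ≥ 0`, the recursive inequality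
`E k t ≤ ε (1+t)^(c₀ ε) + ε E k 0 + ∫₀ᵗ ε (1+τ)^(c ε - 1) E (k-1) τ dτ + ∫₀ᵗ (ε/(1+τ)) E k τ dτ`
(the term involving `E (k-1)` being absent when `k = 0`), one has
`E k t ≤ C ε (1+t)^(c′ ε)` for every `k ∈ {0,…,K}` and every `t ≥ 0`. -/
theorem recursive_gronwall_scheme (K : ℕ) (c₀ c : ℝ) (hc₀ : 0 < c₀) (hc : 0 < c) :
    ∃ C > (0 : ℝ), ∃ c' > (0 : ℝ),
      ∀ ε : ℝ, 0 < ε → ε ≤ 1 / 2 →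
      ∀ E : ℕ → ℝ → ℝ,
        (∀ k ≤ K, ContinuousOn (E k) (Set.Ici (0 : ℝ))) →
        (∀ k ≤ K, ∀ t : ℝ, 0 ≤ t → 0 ≤ E k t) →
        (∀ k ≤ K, ∀ t : ℝ, 0 ≤ t →
          E k t ≤ ε * (1 + t) ^ (c₀ * ε) + ε * E k 0
            + (if k = 0 then 0 else
                ∫ τ in (0 : ℝ)..t, ε * (1 + τ) ^ (c * ε - 1) * E (k - 1) τ)
            + ∫ τ in (0 : ℝ)..t, (ε / (1 + τ)) * E k τ) →
        ∀ k ≤ K, ∀ t : ℝ, 0 ≤ t → E k t ≤ C * ε * (1 + t) ^ (c' * ε) := by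
  obtain ⟨C, hC, a, ha, h⟩ := rgs_main K c₀ c hc₀ hc
  exact ⟨C, hC, a, by linarith, h⟩
end

section
/- Let γ′ > 0 and define w : ℝ → ℝ by w(q) = (1+|q|)^{1+2γ′} for q > 0 and w(q) = 1 for q ≤ 0. There exists a constant c > 0, depending only on γ′, such that for every t ≥ 0, every a ∈ [0,2], and every continuously differentiable function f : ℝ → ℝ with compact support, one has ∫₀^∞ (1+t+r)^{−a} · w(r−t) · (1+|r−t|)^{−2} · f(r)² · r² dr ≤ c · ∫₀^∞ (1+t+r)^{−a} · w(r−t) · f′(r)² · r² dr. -/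
open MeasureTheory

lemma wh_cont (γ' : ℝ) (w : ℝ → ℝ)
    (hw : ∀ q : ℝ, w q = if 0 < q then (1 + |q|) ^ (1 + 2 * γ') else 1) : Continuous w := by
  have : w = fun q => (1 + max q 0) ^ (1 + 2 * γ') := by
    funext q
    rw [hw]
    split_ifs with h
    · rw [abs_of_pos h, max_eq_left h.le]
    · rw [max_eq_right (not_lt.mp h)]; simp
  rw [this]
  refine Continuous.rpow_const (by fun_prop) (fun q => Or.inl ?_)
  have := le_max_right q 0
  positivity

lemma wh_deriv (γ' : ℝ) (hγ' : 0 < γ') (w : ℝ → ℝ)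
    (hw : ∀ q : ℝ, w q = if 0 < q then (1 + |q|) ^ (1 + 2 * γ') else 1) (q : ℝ) :
    ∃ u' : ℝ, HasDerivWithinAt (fun q => w q / (1 + |q|)) u' (Set.Ioi q) q ∧
      min 1 (2 * γ') * (w q / (1 + |q|)) / (1 + |q|) ≤ u' := by
  have key : ∀ x : ℝ, 0 ≤ x → w x / (1 + |x|) = (1 + x) ^ (2 * γ') := by
    intro x hx
    have h1 : 0 < 1 + x := by positivity
    rw [hw, abs_of_nonneg hx]
    split_ifs with h
    · rw [Real.rpow_add h1, Real.rpow_one]; field_simp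
    · have : x = 0 := le_antisymm (not_lt.mp h) hx
      subst this; simp
  rcases lt_or_ge q 0 with h | h
  · have h1 : 0 < 1 - q := by linarith
    refine ⟨1 / (1 - q) ^ 2, ?_, ?_⟩
    · have h2 : HasDerivAt (fun q : ℝ => (1 - q)⁻¹) (1 / (1 - q) ^ 2) q := by
        have := ((hasDerivAt_id q).const_sub 1).inv h1.ne'
        refine HasDerivAt.congr_deriv this ?_
        simp
      refine HasDerivAt.hasDerivWithinAt (h2.congr_of_eventuallyEq ?_)
      filter_upwards [Iio_mem_nhds h] with x hx
      have hx : x < 0 := hx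
      simp [hw, not_lt.mpr hx.le, abs_of_neg hx, sub_eq_add_neg]
    · rw [hw, if_neg (not_lt.mpr h.le), abs_of_neg h, ← sub_eq_add_neg]
      have : min 1 (2 * γ') ≤ 1 := min_le_left _ _
      rw [mul_one_div, div_div, ← sq]
      gcongr
  · have h1 : 0 < 1 + q := by linarith
    refine ⟨2 * γ' * (1 + q) ^ (2 * γ' - 1), ?_, ?_⟩
    · have h2 : HasDerivAt (fun q : ℝ => (1 + q) ^ (2 * γ')) (2 * γ' * (1 + q) ^ (2 * γ' - 1)) q := by
        have := ((hasDerivAt_id q).const_add 1).rpow_const (p := 2 * γ') (Or.inl h1.ne')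
        simpa using this
      refine h2.hasDerivWithinAt.congr (fun x hx => key x ?_) (key q h)
      exact h.trans (le_of_lt hx)
    · rw [key q h, abs_of_nonneg h, Real.rpow_sub h1, Real.rpow_one, mul_div_assoc]
      gcongr
      exact min_le_right _ _

/-- **Weighted Hardy-type inequality (radial form, Lemma 6.3).**
Let `γ' > 0` and `w(q) = (1+|q|)^(1+2γ')` for `q > 0`, `w(q) = 1` for `q ≤ 0`.
There is a constant `c > 0` depending only on `γ'` such that for every `t ≥ 0`,
every `a ∈ [0,2]` and every `C¹` function `f : ℝ → ℝ` of compact support,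
`∫₀^∞ (1+t+r)^(-a) w(r-t) (1+|r-t|)^(-2) f(r)² r² dr
  ≤ c ∫₀^∞ (1+t+r)^(-a) w(r-t) f'(r)² r² dr`. -/
theorem weighted_hardy_type_inequality
    (γ' : ℝ) (hγ' : 0 < γ')
    (w : ℝ → ℝ)
    (hw : ∀ q : ℝ, w q = if 0 < q then (1 + |q|) ^ (1 + 2 * γ') else 1) :
    ∃ c > (0 : ℝ), ∀ t : ℝ, 0 ≤ t → ∀ a : ℝ, 0 ≤ a → a ≤ 2 →
      ∀ f : ℝ → ℝ, ContDiff ℝ 1 f → HasCompactSupport f →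
        (∫ r in Set.Ioi (0 : ℝ),
            (1 + t + r) ^ (-a) * w (r - t) * (1 + |r - t|) ^ (-(2 : ℝ)) * f r ^ 2 * r ^ 2)
          ≤ c * ∫ r in Set.Ioi (0 : ℝ),
              (1 + t + r) ^ (-a) * w (r - t) * deriv f r ^ 2 * r ^ 2 := by
  have hwc := wh_cont γ' w hw
  have hwpos : ∀ q, 0 < w q := by
    intro q; rw [hw]; split_ifs <;> positivity
  choose u' hu' hu'k using wh_deriv γ' hγ' w hw
  set k := min 1 (2 * γ') with hk
  have hkpos : 0 < k := by rw [hk]; positivity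
  refine ⟨4 / k ^ 2, by positivity, ?_⟩
  intro t ht a ha ha2 f hf hfc
  have hf' : Continuous (deriv f) := hf.continuous_deriv (le_refl _)
  have hfcont := hf.continuous
  have hfd : ∀ x, HasDerivAt f (deriv f x) x :=
    fun x => (hf.differentiable (by norm_num) x).hasDerivAt
  obtain ⟨R₀, hR₀⟩ := hfc.isCompact.isBounded.subset_closedBall 0
  set R := max R₀ 0 with hR
  have hRnn : 0 ≤ R := le_max_right _ _
  have hout : ∀ x, R < x → x ∉ tsupport f := by
    intro x hx hx2
    have h1 := hR₀ hx2
    rw [Metric.mem_closedBall, dist_zero_right, Real.norm_eq_abs] at h1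
    have := le_abs_self x
    have := le_max_left R₀ 0
    linarith
  have hf0 : ∀ x, R < x → f x = 0 := fun x hx => image_eq_zero_of_notMem_tsupport (hout x hx)
  have hd0 : ∀ x, R < x → deriv f x = 0 := fun x hx =>
    image_eq_zero_of_notMem_tsupport (fun h => hout x hx (tsupport_deriv_subset h))
  have hfR : f (R + 1) = 0 := hf0 _ (by linarith)
  -- reduction to interval
  have red : ∀ F : ℝ → ℝ, (∀ x, R < x → F x = 0) →
      ∫ r in Set.Ioi (0 : ℝ), F r = ∫ r in (0 : ℝ)..(R + 1), F r := by
    intro F hF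
    rw [intervalIntegral.integral_of_le (by linarith)]
    apply setIntegral_eq_of_subset_of_forall_sdiff_eq_zero measurableSet_Ioi
      (fun x hx => hx.1)
    intro x hx
    apply hF
    by_contra hcon
    exact hx.2 ⟨hx.1, by linarith⟩
  rw [red _ (fun x hx => by simp [hf0 x hx]), red _ (fun x hx => by simp [hd0 x hx])]
  have hA : ContinuousOn (fun r : ℝ => (1 + t + r) ^ (-a)) (Set.Icc 0 (R + 1)) := by
    apply ContinuousOn.rpow_const (by fun_prop)
    intro x hx
    have := hx.1
    left; positivity
  have hS : Continuous (fun r : ℝ => (1 + |r - t|) ^ (-(2 : ℝ))) := by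
    apply Continuous.rpow_const (by fun_prop)
    intro x
    left; positivity
  have hwt : Continuous (fun r : ℝ => w (r - t)) := hwc.comp (by fun_prop)
  have c1 : ContinuousOn (fun r : ℝ => (1 + t + r) ^ (-a) * w (r - t) * (1 + |r - t|) ^ (-(2 : ℝ))
      * f r ^ 2 * r ^ 2) (Set.Icc 0 (R + 1)) :=
    (((hA.mul hwt.continuousOn).mul hS.continuousOn).mul (hfcont.pow 2).continuousOn).mul
      (by fun_prop)
  have c2 : ContinuousOn (fun r : ℝ => (1 + t + r) ^ (-a) * w (r - t) * deriv f r ^ 2 * r ^ 2)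
      (Set.Icc 0 (R + 1)) :=
    ((hA.mul hwt.continuousOn).mul (hf'.pow 2).continuousOn).mul (by fun_prop)
  have hle : (0 : ℝ) ≤ R + 1 := by linarith
  have i1 := c1.intervalIntegrable_of_Icc (μ := volume) hle
  have i2 := c2.intervalIntegrable_of_Icc (μ := volume) hle
  have cg : ContinuousOn (fun r : ℝ => (1 + t + r) ^ (-a) * r ^ 2 * (w (r - t) / (1 + |r - t|))
      * f r ^ 2) (Set.Icc 0 (R + 1)) := by
    refine ((hA.mul (by fun_prop)).mul (Continuous.continuousOn ?_)).mul
      (hfcont.pow 2).continuousOn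
    exact hwt.div (by fun_prop) (fun x => by positivity)
  have main := intervalIntegral.integral_le_sub_of_hasDeriv_right_of_le
    (g := fun r : ℝ => (1 + t + r) ^ (-a) * r ^ 2 * (w (r - t) / (1 + |r - t|)) * f r ^ 2)
    (g' := fun r : ℝ => ((1 * (-a) * (1 + t + r) ^ (-a - 1) * r ^ 2 + (1 + t + r) ^ (-a) * (2 * r))
        * (w (r - t) / (1 + |r - t|)) + (1 + t + r) ^ (-a) * r ^ 2 * u' (r - t)) * f r ^ 2
        + (1 + t + r) ^ (-a) * r ^ 2 * (w (r - t) / (1 + |r - t|)) * (2 * f r * deriv f r))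
    (φ := fun r : ℝ => k / 2 * ((1 + t + r) ^ (-a) * w (r - t) * (1 + |r - t|) ^ (-(2 : ℝ))
      * f r ^ 2 * r ^ 2) - 2 / k * ((1 + t + r) ^ (-a) * w (r - t) * deriv f r ^ 2 * r ^ 2))
    hle cg ?_ ?_ ?_
  · rw [intervalIntegral.integral_sub (i1.const_mul _) (i2.const_mul _),
      intervalIntegral.integral_const_mul, intervalIntegral.integral_const_mul, hfR] at main
    simp only [ne_eq, OfNat.ofNat_ne_zero, not_false_eq_true, zero_pow, mul_zero, zero_mul,
      sub_zero] at main
    set I := ∫ r in (0 : ℝ)..(R + 1), (1 + t + r) ^ (-a) * w (r - t) * (1 + |r - t|) ^ (-(2 : ℝ))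
      * f r ^ 2 * r ^ 2
    set J := ∫ r in (0 : ℝ)..(R + 1), (1 + t + r) ^ (-a) * w (r - t) * deriv f r ^ 2 * r ^ 2
    have e : I - 4 / k ^ 2 * J = 2 / k * (k / 2 * I - 2 / k * J) := by field_simp; ring
    have : 2 / k * (k / 2 * I - 2 / k * J) ≤ 0 :=
      mul_nonpos_of_nonneg_of_nonpos (by positivity) main
    linarith
  · intro x hx
    have hx0 : 0 < x := hx.1
    have hp : 0 < 1 + t + x := by positivity
    have d1 : HasDerivAt (fun r : ℝ => (1 + t + r) ^ (-a)) (1 * (-a) * (1 + t + x) ^ (-a - 1)) x :=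
      ((hasDerivAt_id x).const_add (1 + t)).rpow_const (Or.inl hp.ne')
    have d2 : HasDerivAt (fun r : ℝ => r ^ 2) (2 * x) x := by
      simpa using hasDerivAt_pow 2 x
    have d3 : HasDerivWithinAt (fun r : ℝ => w (r - t) / (1 + |r - t|)) (u' (x - t))
        (Set.Ioi x) x := by
      have := HasDerivWithinAt.comp (h := fun r : ℝ => r - t) (h' := 1) (s := Set.Ioi x) x
        (hu' (x - t)) ((hasDerivAt_id x).sub_const t).hasDerivWithinAt
        (fun y hy => by
          have hy : x < y := hy
          show x - t < y - t
          linarith)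
      simpa [Function.comp_def] using this
    have d4 : HasDerivAt (fun r : ℝ => f r ^ 2) (2 * f x * deriv f x) x := by
      refine HasDerivAt.congr_deriv ((hfd x).pow 2) ?_
      simp
    exact (((d1.mul d2).hasDerivWithinAt.mul d3).mul d4.hasDerivWithinAt)
  · exact ((continuousOn_const.mul c1).sub (continuousOn_const.mul c2)).integrableOn_Icc
  · intro x hx
    have hx0 : 0 < x := hx.1
    have hp : 0 < 1 + t + x := by positivity
    have hs : 0 < 1 + |x - t| := by positivity
    have hW := hwpos (x - t)
    have hU := hu'k (x - t)
    have hApos : 0 < (1 + t + x) ^ (-a) := Real.rpow_pos_of_pos hp _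
    have e2 : (1 + |x - t|) ^ (-(2 : ℝ)) = 1 / (1 + |x - t|) ^ 2 := by
      rw [Real.rpow_neg hs.le, Real.rpow_two, one_div]
    have e1 : (1 + t + x) ^ (-a - 1) = (1 + t + x) ^ (-a) / (1 + t + x) := by
      rw [Real.rpow_sub hp, Real.rpow_one]
    simp only [e1, e2]
    generalize (1 + t + x) ^ (-a) = A at *
    generalize 1 + |x - t| = s at *
    generalize w (x - t) = W at *
    generalize u' (x - t) = U at *
    generalize f x = y at *
    generalize deriv f x = z at *
    have hB : 0 ≤ 1 * -a * (A / (1 + t + x)) * x ^ 2 + A * (2 * x) := by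
      have : 1 * -a * (A / (1 + t + x)) * x ^ 2 + A * (2 * x)
          = A * x / (1 + t + x) * (2 * (1 + t) + (2 - a) * x) := by field_simp; ring
      rw [this]
      have : 0 ≤ 2 - a := by linarith
      positivity
    have h1 : 0 ≤ (1 * -a * (A / (1 + t + x)) * x ^ 2 + A * (2 * x)) * (W / s) * y ^ 2 := by
      positivity
    have h2 : A * x ^ 2 * y ^ 2 * (k * (W / s) / s) ≤ A * x ^ 2 * y ^ 2 * U :=
      mul_le_mul_of_nonneg_left hU (by positivity)
    have h3 : 0 ≤ A * x ^ 2 * (W / s) * (2 / (k * s) * (k * y / 2 + s * z) ^ 2) := by positivity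
    have h4 : A * x ^ 2 * (W / s) * (2 / (k * s) * (k * y / 2 + s * z) ^ 2)
        = A * x ^ 2 * y ^ 2 * (k * (W / s) / s) + A * x ^ 2 * (W / s) * (2 * y * z)
          - (k / 2 * (A * W * (1 / s ^ 2) * y ^ 2 * x ^ 2) - 2 / k * (A * W * z ^ 2 * x ^ 2)) := by
      field_simp; ring
    linarith
end

section
/- There exists an absolute constant C > 0 such that for every differentiable function u : ℝ × ℝ³ → ℝ and every point (t, x) with t ≥ 0 and x ≠ 0, the following holds. Write r = |x|, q = r − t, ω = x/r, L = (1, ω) ∈ ℝ⁴, and let e₁, e₂ ∈ ℝ³ complete ω to an orthonormal basis of ℝ³. Then (1 + t + |q|)·( |du_{(t,x)}(L)| + |du_{(t,x)}((0,e₁))| + |du_{(t,x)}((0,e₂))| ) + (1 + |q|)·|∇_{t,x} u(t,x)| ≤ C·( |u(t,x)| + Σ_{Z ∈ 𝒵} |du_{(t,x)}(Z(t,x))| ), where |∇_{t,x} u| denotes the Euclidean norm of the full space-time gradient (∂_t u, ∂₁u, ∂₂u, ∂₃u). -/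
noncomputable section

/-- Spatial slice `ℝ³` with its Euclidean norm. -/
abbrev Space3 := EuclideanSpace ℝ (Fin 3)

/-- Space-time `ℝ^(1+3)` with coordinates `(t, x)`. -/
abbrev Spacetime := ℝ × Space3

/-- The `i`-th standard basis vector of `ℝ³`. -/
def eVec (i : Fin 3) : Space3 := EuclideanSpace.single i 1

/-- The coordinate direction `∂_α`, `α ∈ {0,1,2,3}`, as a vector of space-time. -/
def coordDir : Fin 4 → Spacetime :=
  ![(1, 0), (0, eVec 0), (0, eVec 1), (0, eVec 2)]

/-- The coordinates with lowered index, `x_β = m_{βμ} x^μ`, for `m = diag(−1,1,1,1)`. -/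
def xLower (p : Spacetime) : Fin 4 → ℝ :=
  ![-p.1, p.2 0, p.2 1, p.2 2]

/-- The rotation/boost vector field `Z_{αβ} = x_β ∂_α − x_α ∂_β`. -/
def rotVF (α β : Fin 4) : Spacetime → Spacetime :=
  fun p => xLower p β • coordDir α - xLower p α • coordDir β

lemma aux_mul_le {w A M : ℝ} (hw : |w| ≤ 1) (hA : |A| ≤ M) : |w * A| ≤ M := by
  rw [abs_mul]
  nlinarith [abs_nonneg w, abs_nonneg A]

lemma aux_D (D : Spacetime →L[ℝ] ℝ) (s : ℝ) (y : Space3) :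
    D (s, y) = s * D (1, 0) + y 0 * D (0, eVec 0) + y 1 * D (0, eVec 1) + y 2 * D (0, eVec 2) := by
  have h : ((s, y) : Spacetime) = s • ((1, 0) : Spacetime) + y 0 • ((0, eVec 0) : Spacetime)
      + y 1 • ((0, eVec 1) : Spacetime) + y 2 • ((0, eVec 2) : Spacetime) := by
    ext i
    · simp
    · fin_cases i <;> simp [eVec]
  rw [h]
  simp only [map_add, map_smul, smul_eq_mul]

lemma aux_comp {y : Space3} (h : ‖y‖ = 1) (i : Fin 3) : |y i| ≤ 1 := by
  have := PiLp.norm_apply_le y i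
  rw [h] at this
  simpa using this

/-- estimate for an angular derivative -/
lemma aux_tang (t r M b0 b1 b2 w0 w1 w2 e0 e1 e2 a : ℝ) (ht : 0 ≤ t) (hr : 0 ≤ r)
    (hw : w0 ^ 2 + w1 ^ 2 + w2 ^ 2 = 1) (hw0 : |w0| ≤ 1) (hw1 : |w1| ≤ 1) (hw2 : |w2| ≤ 1)
    (he0 : |e0| ≤ 1) (he1 : |e1| ≤ 1) (he2 : |e2| ≤ 1)
    (hwe : w0 * e0 + w1 * e1 + w2 * e2 = 0)
    (hb0 : |b0| ≤ M) (hb1 : |b1| ≤ M) (hb2 : |b2| ≤ M)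
    (hB0 : |r * w0 * a + t * b0| ≤ M) (hB1 : |r * w1 * a + t * b1| ≤ M)
    (hB2 : |r * w2 * a + t * b2| ≤ M)
    (hR01 : |r * w1 * b0 - r * w0 * b1| ≤ M) (hR02 : |r * w2 * b0 - r * w0 * b2| ≤ M)
    (hR12 : |r * w2 * b1 - r * w1 * b2| ≤ M) :
    (1 + t + |r - t|) * |e0 * b0 + e1 * b1 + e2 * b2| ≤ 18 * M := by
  set E := e0 * b0 + e1 * b1 + e2 * b2 with hE
  have h1 : |E| ≤ 3 * M := by
    have := aux_mul_le he0 hb0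
    have := aux_mul_le he1 hb1
    have := aux_mul_le he2 hb2
    rw [abs_le] at *
    constructor <;> linarith
  have h2 : t * |E| ≤ 3 * M := by
    have k0 := aux_mul_le he0 hB0
    have k1 := aux_mul_le he1 hB1
    have k2 := aux_mul_le he2 hB2
    have : t * E = e0 * (r * w0 * a + t * b0) + e1 * (r * w1 * a + t * b1)
        + e2 * (r * w2 * a + t * b2) := by
      rw [hE]; linear_combination (-r * a) * hwe
    rw [← abs_of_nonneg ht, ← abs_mul, this]
    rw [abs_le] at k0 k1 k2 ⊢
    constructor <;> linarith
  have h3 : r * |E| ≤ 6 * M := by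
    have a1 := aux_mul_le he0 (aux_mul_le hw1 hR01)
    have a2 := aux_mul_le he0 (aux_mul_le hw2 hR02)
    have a3 := aux_mul_le he1 (aux_mul_le hw0 hR01)
    have a4 := aux_mul_le he1 (aux_mul_le hw2 hR12)
    have a5 := aux_mul_le he2 (aux_mul_le hw0 hR02)
    have a6 := aux_mul_le he2 (aux_mul_le hw1 hR12)
    have : r * E = e0 * (w1 * (r * w1 * b0 - r * w0 * b1)) + e0 * (w2 * (r * w2 * b0 - r * w0 * b2))
       - e1 * (w0 * (r * w1 * b0 - r * w0 * b1)) + e1 * (w2 * (r * w2 * b1 - r * w1 * b2))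
       - e2 * (w0 * (r * w2 * b0 - r * w0 * b2)) - e2 * (w1 * (r * w2 * b1 - r * w1 * b2)) := by
      rw [hE]
      linear_combination (-r * (e0 * b0 + e1 * b1 + e2 * b2)) * hw
        + (r * (w0 * b0 + w1 * b1 + w2 * b2)) * hwe
    rw [← abs_of_nonneg hr, ← abs_mul, this]
    rw [abs_le] at a1 a2 a3 a4 a5 a6 ⊢
    constructor <;> linarith
  have hq : |r - t| ≤ r + t := by rw [abs_le]; constructor <;> linarith
  have h4 := mul_le_mul_of_nonneg_right hq (abs_nonneg E)
  have hM : 0 ≤ M := (abs_nonneg b0).trans hb0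
  have h5 : (1 + t + |r - t|) * |E| = |E| + t * |E| + |r - t| * |E| := by ring
  have h6 : (r + t) * |E| = r * |E| + t * |E| := by ring
  linarith

lemma aux_rad (t r M b0 b1 b2 w0 w1 w2 a : ℝ) (ht : 0 ≤ t) (hr : 0 ≤ r)
    (hw : w0 ^ 2 + w1 ^ 2 + w2 ^ 2 = 1) (hw0 : |w0| ≤ 1) (hw1 : |w1| ≤ 1) (hw2 : |w2| ≤ 1)
    (ha : |a| ≤ M) (hb0 : |b0| ≤ M) (hb1 : |b1| ≤ M) (hb2 : |b2| ≤ M)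
    (hS : |t * a + r * w0 * b0 + r * w1 * b1 + r * w2 * b2| ≤ M)
    (hB0 : |r * w0 * a + t * b0| ≤ M) (hB1 : |r * w1 * a + t * b1| ≤ M)
    (hB2 : |r * w2 * a + t * b2| ≤ M)
    (hR01 : |r * w1 * b0 - r * w0 * b1| ≤ M) (hR02 : |r * w2 * b0 - r * w0 * b2| ≤ M)
    (hR12 : |r * w2 * b1 - r * w1 * b2| ≤ M) :
    (1 + t + |r - t|) * |a + w0 * b0 + w1 * b1 + w2 * b2|
      + (1 + |r - t|) * √(a ^ 2 + (b0 ^ 2 + b1 ^ 2 + b2 ^ 2)) ≤ 64 * M := by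
  have hq : |r - t| ≤ r + t := by rw [abs_le]; constructor <;> linarith
  have k0 := aux_mul_le hw0 hB0
  have k1 := aux_mul_le hw1 hB1
  have k2 := aux_mul_le hw2 hB2
  set F := a + w0 * b0 + w1 * b1 + w2 * b2 with hF
  have f1 : |F| ≤ 4 * M := by
    have := aux_mul_le hw0 hb0
    have := aux_mul_le hw1 hb1
    have := aux_mul_le hw2 hb2
    rw [abs_le] at *
    constructor <;> linarith
  have f2 : (t + r) * |F| ≤ 4 * M := by
    have : (t + r) * F = (t * a + r * w0 * b0 + r * w1 * b1 + r * w2 * b2)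
        + w0 * (r * w0 * a + t * b0) + w1 * (r * w1 * a + t * b1)
        + w2 * (r * w2 * a + t * b2) := by
      rw [hF]; linear_combination (-r * a) * hw
    rw [← abs_of_nonneg (add_nonneg ht hr), ← abs_mul, this]
    rw [abs_le] at k0 k1 k2 hS ⊢
    constructor <;> linarith
  have f3 : r * |F| ≤ 4 * M := by
    have := mul_nonneg ht (abs_nonneg F)
    linarith [add_mul t r |F|]
  have f4 : |(r - t) * F| ≤ 4 * M := by
    rw [abs_mul]
    have := mul_le_mul_of_nonneg_right hq (abs_nonneg F)
    rw [add_comm r t] at this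
    linarith
  have f5 : |r * F| ≤ 4 * M := by rwa [abs_mul, abs_of_nonneg hr]
  have g0 : |r - t| * |a| ≤ 4 * M := by
    have : 2 * ((r - t) * a) = (r - t) * F - (t * a + r * w0 * b0 + r * w1 * b1 + r * w2 * b2)
        + w0 * (r * w0 * a + t * b0) + w1 * (r * w1 * a + t * b1)
        + w2 * (r * w2 * a + t * b2) := by
      rw [hF]; linear_combination (-r * a) * hw
    rw [← abs_mul]
    rw [abs_le] at k0 k1 k2 hS f4 ⊢
    constructor <;> linarith
  have c0 : |r - t| * |b0| ≤ 8 * M := by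
    have : (r - t) * b0 = w0 * (r * F) - (r * w0 * a + t * b0)
        + w1 * (r * w1 * b0 - r * w0 * b1) + w2 * (r * w2 * b0 - r * w0 * b2) := by
      rw [hF]; linear_combination (-r * b0) * hw
    have p1 := aux_mul_le hw0 f5
    have p2 := aux_mul_le hw1 hR01
    have p3 := aux_mul_le hw2 hR02
    rw [← abs_mul, this]
    rw [abs_le] at p1 p2 p3 hB0 ⊢
    constructor <;> linarith
  have c1 : |r - t| * |b1| ≤ 8 * M := by
    have : (r - t) * b1 = w1 * (r * F) - (r * w1 * a + t * b1)
        - w0 * (r * w1 * b0 - r * w0 * b1) + w2 * (r * w2 * b1 - r * w1 * b2) := by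
      rw [hF]; linear_combination (-r * b1) * hw
    have p1 := aux_mul_le hw1 f5
    have p2 := aux_mul_le hw0 hR01
    have p3 := aux_mul_le hw2 hR12
    rw [← abs_mul, this]
    rw [abs_le] at p1 p2 p3 hB1 ⊢
    constructor <;> linarith
  have c2 : |r - t| * |b2| ≤ 8 * M := by
    have : (r - t) * b2 = w2 * (r * F) - (r * w2 * a + t * b2)
        - w0 * (r * w2 * b0 - r * w0 * b2) - w1 * (r * w2 * b1 - r * w1 * b2) := by
      rw [hF]; linear_combination (-r * b2) * hw
    have p1 := aux_mul_le hw2 f5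
    have p2 := aux_mul_le hw0 hR02
    have p3 := aux_mul_le hw1 hR12
    rw [← abs_mul, this]
    rw [abs_le] at p1 p2 p3 hB2 ⊢
    constructor <;> linarith
  have s : √(a ^ 2 + (b0 ^ 2 + b1 ^ 2 + b2 ^ 2)) ≤ |a| + |b0| + |b1| + |b2| := by
    apply Real.sqrt_le_iff.2
    constructor
    · positivity
    · rw [← sq_abs a, ← sq_abs b0, ← sq_abs b1, ← sq_abs b2]
      have := abs_nonneg a
      have := abs_nonneg b0
      have := abs_nonneg b1
      have := abs_nonneg b2
      have : 0 ≤ |a| * |b0| + |a| * |b1| + |a| * |b2| + |b0| * |b1| + |b0| * |b2| + |b1| * |b2| := by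
        positivity
      have e : (|a| + |b0| + |b1| + |b2|) ^ 2 = |a| ^ 2 + (|b0| ^ 2 + |b1| ^ 2 + |b2| ^ 2)
        + 2 * (|a| * |b0| + |a| * |b1| + |a| * |b2| + |b0| * |b1| + |b0| * |b2| + |b1| * |b2|) := by
        ring
      linarith
  have s2 := mul_le_mul_of_nonneg_left s (by positivity : 0 ≤ 1 + |r - t|)
  have s3 : (1 + t + |r - t|) * |F| ≤ 12 * M := by
    have h4 := mul_le_mul_of_nonneg_right hq (abs_nonneg F)
    have h5 : (1 + t + |r - t|) * |F| = |F| + t * |F| + |r - t| * |F| := by ring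
    have h6 : (r + t) * |F| = r * |F| + t * |F| := by ring
    have h7 : (t + r) * |F| = r * |F| + t * |F| := by ring
    have h8 := mul_nonneg ht (abs_nonneg F)
    have h9 := mul_nonneg hr (abs_nonneg F)
    linarith
  have hM : 0 ≤ M := (abs_nonneg a).trans ha
  have s4 : (1 + |r - t|) * (|a| + |b0| + |b1| + |b2|) = |a| + |b0| + |b1| + |b2|
      + |r - t| * |a| + |r - t| * |b0| + |r - t| * |b1| + |r - t| * |b2| := by ring
  linarith

/-- **Pointwise control of tangential and transversal derivatives (Section 3).**
There is an absolute constant `C > 0` such that for every differentiable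
`u : ℝ × ℝ³ → ℝ`, every `t ≥ 0` and every `x ≠ 0`, writing `q = |x| − t`,
`ω = x/|x|`, `L = (1,ω)`, and letting `e₁, e₂` complete `ω` to an orthonormal basis
of `ℝ³`, one has
`(1+t+|q|)(|du(L)| + |du((0,e₁))| + |du((0,e₂))|) + (1+|q|)·|∇_{t,x} u|
  ≤ C (|u| + Σ_{Z ∈ 𝒵} |du(Z)|)`,
where `𝒵` consists of the translations `∂_α`, the fields `Z_{αβ}` and the scaling `S`. -/
theorem tangential_derivative_pointwise_estimate :
    ∃ C > (0 : ℝ), ∀ u : Spacetime → ℝ, Differentiable ℝ u →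
      ∀ t : ℝ, 0 ≤ t → ∀ x : Space3, x ≠ 0 →
      ∀ e₁ e₂ : Space3, Orthonormal ℝ ![‖x‖⁻¹ • x, e₁, e₂] →
        (1 + t + |‖x‖ - t|) *
            (|fderiv ℝ u (t, x) (1, ‖x‖⁻¹ • x)| +
              |fderiv ℝ u (t, x) (0, e₁)| + |fderiv ℝ u (t, x) (0, e₂)|)
          + (1 + |‖x‖ - t|) *
              Real.sqrt ((fderiv ℝ u (t, x) (1, 0)) ^ 2 +
                ∑ i : Fin 3, (fderiv ℝ u (t, x) (0, eVec i)) ^ 2)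
        ≤ C * (|u (t, x)|
            + (∑ α : Fin 4, |fderiv ℝ u (t, x) (coordDir α)|)
            + (∑ α : Fin 4, ∑ β : Fin 4, |fderiv ℝ u (t, x) (rotVF α β (t, x))|)
            + |fderiv ℝ u (t, x) (t, x)|) := by
  refine ⟨100, by norm_num, ?_⟩
  intro u _ t ht x hx e₁ e₂ ho
  generalize fderiv ℝ u (t, x) = D
  set M := |u (t, x)| + (∑ α : Fin 4, |D (coordDir α)|)
    + (∑ α : Fin 4, ∑ β : Fin 4, |D (rotVF α β (t, x))|) + |D (t, x)| with hM
  have n1 : 0 ≤ |u (t, x)| := abs_nonneg _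
  have n2 : 0 ≤ |D (t, x)| := abs_nonneg _
  have n3 : 0 ≤ ∑ α : Fin 4, |D (coordDir α)| := Finset.sum_nonneg fun _ _ => abs_nonneg _
  have n4 : 0 ≤ ∑ α : Fin 4, ∑ β : Fin 4, |D (rotVF α β (t, x))| :=
    Finset.sum_nonneg fun _ _ => Finset.sum_nonneg fun _ _ => abs_nonneg _
  have hc (α : Fin 4) : |D (coordDir α)| ≤ M := by
    have := Finset.single_le_sum (f := fun α => |D (coordDir α)|)
      (fun _ _ => abs_nonneg _) (Finset.mem_univ α)
    linarith
  have hR (α β : Fin 4) : |D (rotVF α β (t, x))| ≤ M := by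
    have h1 := Finset.single_le_sum (f := fun β => |D (rotVF α β (t, x))|)
      (fun _ _ => abs_nonneg _) (Finset.mem_univ β)
    have h2 := Finset.single_le_sum (f := fun α => ∑ β : Fin 4, |D (rotVF α β (t, x))|)
      (fun _ _ => Finset.sum_nonneg fun _ _ => abs_nonneg _) (Finset.mem_univ α)
    linarith
  have hS : |D (t, x)| ≤ M := by linarith
  clear_value M
  have hr : 0 < ‖x‖ := norm_pos_iff.2 hx
  have hw : ‖‖x‖⁻¹ • x‖ = 1 := ho.1 0
  have he1 : ‖e₁‖ = 1 := ho.1 1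
  have he2 : ‖e₂‖ = 1 := ho.1 2
  have o1 : inner ℝ (‖x‖⁻¹ • x) e₁ = 0 := ho.2 (show (0 : Fin 3) ≠ 1 by decide)
  have o2 : inner ℝ (‖x‖⁻¹ • x) e₂ = 0 := ho.2 (show (0 : Fin 3) ≠ 2 by decide)
  have hxw : x = ‖x‖ • (‖x‖⁻¹ • x) := by
    rw [smul_smul, mul_inv_cancel₀ hr.ne', one_smul]
  generalize ‖x‖⁻¹ • x = w at *
  generalize ‖x‖ = r at *
  subst hxw
  have hw2 : w 0 ^ 2 + w 1 ^ 2 + w 2 ^ 2 = 1 := by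
    have := EuclideanSpace.real_norm_sq_eq w
    rw [hw, Fin.sum_univ_three] at this
    linarith
  have o1' : w 0 * e₁ 0 + w 1 * e₁ 1 + w 2 * e₁ 2 = 0 := by
    simp [PiLp.inner_apply, Fin.sum_univ_three] at o1
    linarith
  have o2' : w 0 * e₂ 0 + w 1 * e₂ 1 + w 2 * e₂ 2 = 0 := by
    simp [PiLp.inner_apply, Fin.sum_univ_three] at o2
    linarith
  have ca := hc 0
  have cb0 := hc 1
  have cb1 := hc 2
  have cb2 := hc 3
  have B0 := hR 0 1
  have B1 := hR 0 2
  have B2 := hR 0 3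
  have R01 := hR 1 2
  have R02 := hR 1 3
  have R12 := hR 2 3
  simp [coordDir] at ca cb0 cb1 cb2
  simp only [rotVF, map_sub, map_smul, smul_eq_mul] at B0 B1 B2 R01 R02 R12
  simp [coordDir, xLower] at B0 B1 B2 R01 R02 R12
  rw [aux_D D t] at hS
  simp only [PiLp.smul_apply, smul_eq_mul] at hS
  rw [aux_D D 1 w, aux_D D 0 e₁, aux_D D 0 e₂, Fin.sum_univ_three]
  simp only [one_mul, zero_mul, zero_add]
  have T1 := aux_tang t r M _ _ _ _ _ _ _ _ _ _ ht hr.le hw2 (aux_comp hw 0) (aux_comp hw 1)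
    (aux_comp hw 2) (aux_comp he1 0) (aux_comp he1 1) (aux_comp he1 2) o1' cb0 cb1 cb2 B0 B1 B2
    R01 R02 R12
  have T2 := aux_tang t r M _ _ _ _ _ _ _ _ _ _ ht hr.le hw2 (aux_comp hw 0) (aux_comp hw 1)
    (aux_comp hw 2) (aux_comp he2 0) (aux_comp he2 1) (aux_comp he2 2) o2' cb0 cb1 cb2 B0 B1 B2
    R01 R02 R12
  have T3 := aux_rad t r M _ _ _ _ _ _ _ ht hr.le hw2 (aux_comp hw 0) (aux_comp hw 1)
    (aux_comp hw 2) ca cb0 cb1 cb2 hS B0 B1 B2 R01 R02 R12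
  linarith

end
end

section
/- Let γ > 0, δ ∈ (0, 1/4], and let γ′ satisfy 0 < γ′ < 1 + γ − δ. There exists a constant C > 0, depending only on γ, γ′ and δ, such that for every ε ∈ (0,1], every T ≥ 0, and every measurable function G : [0,T] × ℝ³ → ℝ satisfying |G(t,x)| ≤ ε²·(1+t+|q|)^{−(2−2δ)}·(1+|q|)^{−(1+γ+δ)} for all (t,x), where q = |x| − t, one has ∫₀^T ∫_{ℝ³} ((1+t)/ε)·(1+t+|q|)^{−2}·G(t,x)²·w_{γ′}(q) dx dt ≤ C·ε³. -/
open MeasureTheory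

noncomputable section

/-- The weight `w_γ` of the energy norm: `w_γ(q) = (1+|q|)^(1+2γ)` for `q > 0`
and `w_γ(q) = 1` for `q ≤ 0`. -/
def wWeight (γ : ℝ) (q : ℝ) : ℝ := if 0 < q then (1 + |q|) ^ (1 + 2 * γ) else 1

lemma wWeight_nonneg (γ q : ℝ) : 0 ≤ wWeight γ q := by
  unfold wWeight; split_ifs <;> positivity

lemma wWeight_le (γ q : ℝ) (h : 0 < γ) : wWeight γ q ≤ (1 + |q|) ^ (1 + 2 * γ) := by
  unfold wWeight; split_ifs
  · exact le_rfl
  · exact Real.one_le_rpow (by linarith [abs_nonneg q]) (by linarith)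

lemma core_pointwise (γ γ' δ a ε t q g : ℝ) (hδ : δ ≤ 1 / 4)
    (hγ'0 : 0 < γ') (ha1 : a ≤ 1) (ha : a ≤ 1 + γ - δ - γ') (ha0 : 0 < a)
    (hε : 0 < ε) (ht : 0 ≤ t)
    (hg : |g| ≤ ε ^ 2 * (1 + t + |q|) ^ (-(2 - 2 * δ)) * (1 + |q|) ^ (-(1 + γ + δ))) :
    ((1 + t) / ε) * (1 + t + |q|) ^ (-(2 : ℝ)) * g ^ 2 * wWeight γ' q ≤
      ε ^ 3 * (1 + t) ^ (-(1 + a)) *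
        ((1 + t + |q|) ^ (-(2 : ℝ)) * (1 + |q|) ^ (-(1 + a))) := by
  have hq := abs_nonneg q
  have hw := wWeight_le γ' q hγ'0
  have hw0 := wWeight_nonneg γ' q
  set m := 1 + |q| with hm
  set s := 1 + t + |q| with hs
  have hm1 : 1 ≤ m := by linarith
  have hs1 : 1 ≤ s := by linarith
  have hm0 : 0 < m := by linarith
  have hs0 : 0 < s := by linarith
  have hms : m ≤ s := by linarith
  have hts : 1 + t ≤ s := by linarith
  have hg2 : g ^ 2 ≤ ε ^ 4 * s ^ (-(4 - 4 * δ)) * m ^ (-(2 + 2 * γ + 2 * δ)) := by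
    have h1 : g ^ 2 ≤ (ε ^ 2 * s ^ (-(2 - 2 * δ)) * m ^ (-(1 + γ + δ))) ^ 2 := by
      rw [← sq_abs]; gcongr
    refine h1.trans (le_of_eq ?_)
    rw [mul_pow, mul_pow, ← Real.rpow_mul_natCast hs0.le, ← Real.rpow_mul_natCast hm0.le, ← pow_mul]
    push_cast
    ring_nf
  have h1 : s ^ (-(1 + a)) ≤ (1 + t) ^ (-(1 + a)) :=
    Real.rpow_le_rpow_of_nonpos (by linarith) hts (by linarith)
  have h2 : s ^ (-(2 - 4 * δ - a)) ≤ m ^ (-(2 - 4 * δ - a)) :=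
    Real.rpow_le_rpow_of_nonpos (by linarith) hms (by linarith)
  have h3 : m ^ (-(2 - 4 * δ - a) + -(2 + 2 * γ + 2 * δ) + (1 + 2 * γ')) ≤ m ^ (-(1 + a)) :=
    Real.rpow_le_rpow_of_exponent_le hm1 (by linarith)
  have h4 : s ^ (-(4 - 4 * δ)) * s = s ^ (-(1 + a)) * s ^ (-(2 - 4 * δ - a)) := by
    rw [← Real.rpow_add_one hs0.ne', ← Real.rpow_add hs0]; ring_nf
  calc ((1 + t) / ε) * s ^ (-(2 : ℝ)) * g ^ 2 * wWeight γ' q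
      ≤ (s / ε) * s ^ (-(2 : ℝ)) * (ε ^ 4 * s ^ (-(4 - 4 * δ)) * m ^ (-(2 + 2 * γ + 2 * δ)))
          * m ^ (1 + 2 * γ') := by gcongr
    _ = ε ^ 3 * (s ^ (-(4 - 4 * δ)) * s) * (s ^ (-(2 : ℝ)) *
          (m ^ (-(2 + 2 * γ + 2 * δ)) * m ^ (1 + 2 * γ'))) := by
        field_simp
    _ = ε ^ 3 * (s ^ (-(1 + a)) * s ^ (-(2 - 4 * δ - a))) * (s ^ (-(2 : ℝ)) *
          (m ^ (-(2 + 2 * γ + 2 * δ)) * m ^ (1 + 2 * γ'))) := by rw [h4]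
    _ ≤ ε ^ 3 * ((1 + t) ^ (-(1 + a)) * m ^ (-(2 - 4 * δ - a))) * (s ^ (-(2 : ℝ)) *
          (m ^ (-(2 + 2 * γ + 2 * δ)) * m ^ (1 + 2 * γ'))) := by gcongr
    _ = ε ^ 3 * (1 + t) ^ (-(1 + a)) * (s ^ (-(2 : ℝ)) *
          m ^ (-(2 - 4 * δ - a) + -(2 + 2 * γ + 2 * δ) + (1 + 2 * γ'))) := by
        rw [Real.rpow_add hm0 (-(2 - 4 * δ - a) + -(2 + 2 * γ + 2 * δ)),
          Real.rpow_add hm0 (-(2 - 4 * δ - a))]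
        ring
    _ ≤ _ := by gcongr

lemma int_line (a : ℝ) (ha : 0 < a) : Integrable (fun q : ℝ => (1 + |q|) ^ (-(1 + a))) := by
  have := integrable_one_add_norm (E := ℝ) (μ := volume) (r := 1 + a) (by simp; linarith)
  simpa using this

lemma radial_bound (a t : ℝ) (ha : 0 < a) (ht : 0 ≤ t) :
    Integrable (fun x : EuclideanSpace ℝ (Fin 3) =>
      (1 + t + |‖x‖ - t|) ^ (-(2 : ℝ)) * (1 + |‖x‖ - t|) ^ (-(1 + a))) ∧
    ∫ x : EuclideanSpace ℝ (Fin 3),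
      (1 + t + |‖x‖ - t|) ^ (-(2 : ℝ)) * (1 + |‖x‖ - t|) ^ (-(1 + a)) ≤
      3 * (volume.real (Metric.ball (0 : EuclideanSpace ℝ (Fin 3)) 1) *
        ∫ q : ℝ, (1 + |q|) ^ (-(1 + a))) := by
  set f : ℝ → ℝ := fun r => (1 + t + |r - t|) ^ (-(2 : ℝ)) * (1 + |r - t|) ^ (-(1 + a)) with hf
  have hI : Integrable (fun r : ℝ => (1 + |r - t|) ^ (-(1 + a))) := (int_line a ha).comp_sub_right t
  have hle : ∀ y ∈ Set.Ioi (0 : ℝ), y ^ 2 * f y ≤ (1 + |y - t|) ^ (-(1 + a)) := by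
    intro y hy
    have hy : 0 < y := hy
    have hq := abs_nonneg (y - t)
    have hys : y ≤ 1 + t + |y - t| := by linarith [le_abs_self (y - t)]
    have hs0 : 0 < 1 + t + |y - t| := by linarith
    have : y ^ 2 * (1 + t + |y - t|) ^ (-(2 : ℝ)) ≤ 1 := by
      rw [Real.rpow_neg hs0.le, ← div_eq_mul_inv, div_le_one (by positivity), Real.rpow_two]
      gcongr
    calc y ^ 2 * f y = (y ^ 2 * (1 + t + |y - t|) ^ (-(2 : ℝ))) * (1 + |y - t|) ^ (-(1 + a)) := by
          simp only [hf]; ring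
      _ ≤ 1 * (1 + |y - t|) ^ (-(1 + a)) := by gcongr
      _ = _ := one_mul _
  have hnn : ∀ y, 0 ≤ y ^ 2 * f y := by
    intro y
    have hq := abs_nonneg (y - t)
    simp only [hf]; positivity
  have hmeas : Measurable (fun y : ℝ => y ^ 2 * f y) := by
    simp only [hf]; fun_prop
  have hint : IntegrableOn (fun y : ℝ => y ^ 2 * f y) (Set.Ioi 0) := by
    refine Integrable.mono' hI.integrableOn hmeas.aestronglyMeasurable ?_
    refine (ae_restrict_iff' measurableSet_Ioi).2 (Filter.Eventually.of_forall fun y hy => ?_)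
    rw [Real.norm_of_nonneg (hnn y)]
    exact hle y hy
  constructor
  · have := (integrable_fun_norm_addHaar (E := EuclideanSpace ℝ (Fin 3)) volume (f := f)).2
      (by simpa using hint)
    exact this
  · have := integral_fun_norm_addHaar (E := EuclideanSpace ℝ (Fin 3)) volume f
    change ∫ x : EuclideanSpace ℝ (Fin 3), f ‖x‖ ≤ _
    rw [this]
    simp only [finrank_euclideanSpace, Fintype.card_fin, smul_eq_mul, nsmul_eq_mul]
    push_cast
    have hb : ∫ y in Set.Ioi (0 : ℝ), y ^ (3 - 1) * f y ≤ ∫ q : ℝ, (1 + |q|) ^ (-(1 + a)) := by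
      calc ∫ y in Set.Ioi (0 : ℝ), y ^ (3 - 1) * f y
          ≤ ∫ y in Set.Ioi (0 : ℝ), (1 + |y - t|) ^ (-(1 + a)) :=
            setIntegral_mono_on hint hI.integrableOn measurableSet_Ioi hle
        _ ≤ ∫ y : ℝ, (1 + |y - t|) ^ (-(1 + a)) :=
            setIntegral_le_integral hI (Filter.Eventually.of_forall fun y => by
              have := abs_nonneg (y - t)
              simp only [Pi.zero_apply]; positivity)
        _ = _ := integral_sub_right_eq_self (fun q : ℝ => (1 + |q|) ^ (-(1 + a))) t
    gcongr

/-- **Estimate of the well-decaying part of the commutator term (core of Lemma 3.3).**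
Let `γ > 0`, `δ ∈ (0,1/4]` and `0 < γ' < 1 + γ − δ`.  There is `C > 0`, depending only
on `γ`, `γ'` and `δ`, such that for every `ε ∈ (0,1]`, every `T ≥ 0` and every
measurable `G` with `|G(t,x)| ≤ ε² (1+t+|q|)^(−(2−2δ)) (1+|q|)^(−(1+γ+δ))`, where
`q = |x| − t`, one has
`∫₀^T ∫_{ℝ³} ((1+t)/ε) (1+t+|q|)^(−2) G(t,x)² w_{γ'}(q) dx dt ≤ C ε³`. -/
theorem commutator_good_part_estimate
    (γ γ' δ : ℝ) (hγ : 0 < γ) (hδ0 : 0 < δ) (hδ : δ ≤ 1 / 4)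
    (hγ'0 : 0 < γ') (hγ' : γ' < 1 + γ - δ) :
    ∃ C > (0 : ℝ), ∀ ε : ℝ, 0 < ε → ε ≤ 1 → ∀ T : ℝ, 0 ≤ T →
      ∀ G : ℝ × EuclideanSpace ℝ (Fin 3) → ℝ, Measurable G →
      (∀ t ∈ Set.Icc (0 : ℝ) T, ∀ x : EuclideanSpace ℝ (Fin 3),
        |G (t, x)| ≤ ε ^ 2 * (1 + t + |‖x‖ - t|) ^ (-(2 - 2 * δ))
          * (1 + |‖x‖ - t|) ^ (-(1 + γ + δ))) →
      (∫ t in Set.Icc (0 : ℝ) T, ∫ x : EuclideanSpace ℝ (Fin 3),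
          ((1 + t) / ε) * (1 + t + |‖x‖ - t|) ^ (-(2 : ℝ)) * G (t, x) ^ 2
            * wWeight γ' (‖x‖ - t))
        ≤ C * ε ^ 3 := by
  obtain ⟨a, ha0, ha1, ha⟩ : ∃ a : ℝ, 0 < a ∧ a ≤ 1 ∧ a ≤ 1 + γ - δ - γ' :=
    ⟨min 1 (1 + γ - δ - γ'), lt_min one_pos (by linarith), min_le_left _ _, min_le_right _ _⟩
  set I : ℝ := ∫ q : ℝ, (1 + |q|) ^ (-(1 + a)) with hI
  set B : ℝ := 3 * (volume.real (Metric.ball (0 : EuclideanSpace ℝ (Fin 3)) 1) * I) with hB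
  have hI0 : 0 ≤ I := integral_nonneg fun q => by
    have := abs_nonneg q
    simp only [Pi.zero_apply]; positivity
  have hB0 : 0 ≤ B := by positivity
  refine ⟨B * I + 1, by positivity, ?_⟩
  intro ε hε _ T _ G _ hG
  have hnn : ∀ t ∈ Set.Icc (0 : ℝ) T, ∀ x : EuclideanSpace ℝ (Fin 3),
      0 ≤ ((1 + t) / ε) * (1 + t + |‖x‖ - t|) ^ (-(2 : ℝ)) * G (t, x) ^ 2
            * wWeight γ' (‖x‖ - t) := by
    intro t ht x
    have := ht.1
    have := wWeight_nonneg γ' (‖x‖ - t)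
    positivity
  have hinner : ∀ t ∈ Set.Icc (0 : ℝ) T, (∫ x : EuclideanSpace ℝ (Fin 3),
      ((1 + t) / ε) * (1 + t + |‖x‖ - t|) ^ (-(2 : ℝ)) * G (t, x) ^ 2
            * wWeight γ' (‖x‖ - t)) ≤ ε ^ 3 * B * (1 + |t|) ^ (-(1 + a)) := by
    intro t ht
    obtain ⟨h1, h2⟩ := radial_bound a t ha0 ht.1
    have ht0 := ht.1
    refine (integral_mono_of_nonneg (Filter.Eventually.of_forall (hnn t ht))
      (h1.const_mul (ε ^ 3 * (1 + t) ^ (-(1 + a)))) (Filter.Eventually.of_forall fun x =>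
        core_pointwise γ γ' δ a ε t (‖x‖ - t) (G (t, x)) hδ hγ'0 ha1 ha ha0 hε ht.1
          (hG t ht x))).trans ?_
    rw [integral_const_mul, abs_of_nonneg ht0]
    calc _ ≤ ε ^ 3 * (1 + t) ^ (-(1 + a)) * B := by gcongr
      _ = _ := by ring
  have hint := (int_line a ha0).const_mul (ε ^ 3 * B)
  calc _ ≤ ∫ t in Set.Icc (0 : ℝ) T, ε ^ 3 * B * (1 + |t|) ^ (-(1 + a)) := by
        refine integral_mono_of_nonneg ?_ hint.integrableOn ?_
        · exact (ae_restrict_iff' measurableSet_Icc).2 (Filter.Eventually.of_forall fun t ht =>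
            integral_nonneg (hnn t ht))
        · exact (ae_restrict_iff' measurableSet_Icc).2 (Filter.Eventually.of_forall hinner)
    _ ≤ ∫ t : ℝ, ε ^ 3 * B * (1 + |t|) ^ (-(1 + a)) :=
        setIntegral_le_integral hint (Filter.Eventually.of_forall fun t => by
          have := abs_nonneg t
          simp only [Pi.zero_apply]; positivity)
    _ = ε ^ 3 * B * I := by rw [integral_const_mul]
    _ ≤ (B * I + 1) * ε ^ 3 := by nlinarith [pow_pos hε 3]

end
end

section
/- Let γ > 0, let γ′ > γ − 1/2 with γ′ > 0, and let c > 0. There exists a constant C > 0, depending only on γ, γ′ and c, such that for every ε ∈ (0,1] with c·ε ≤ 1/4, every T ≥ 0, and all measurable functions u, v : [0,T] × ℝ³ → ℝ satisfying |u(t,x)| ≤ √ε·(1+t+|q|)^{−(1−cε)}·(1+|q|)^{−(1+γ′)} and |v(t,x)| ≤ √ε·(1+t+|q|)^{−(1−cε)}·(1+|q|)^{−(1+γ′)} for all (t,x), where q = |x| − t, one has ∫₀^T ∫_{ℝ³} ((1+t)/ε)·u(t,x)²·v(t,x)²·w_γ(q) dx dt ≤ C·((1+T)^{4cε} − 1).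 -/
open MeasureTheory

noncomputable section

theorem aux_pt (γ γ' d ε t r w U V : ℝ) (hγ' : γ - 1 / 2 < γ') (hγ'0 : 0 < γ')
    (hε : 0 < ε) (hd : d ≤ 1 / 4) (ht : 0 ≤ t)
    (hw0 : 0 ≤ w) (hw : w ≤ (1 + |r - t|) ^ (1 + 2 * γ))
    (hU : |U| ≤ Real.sqrt ε * (1 + t + |r - t|) ^ (-(1 - d)) * (1 + |r - t|) ^ (-(1 + γ')))
    (hV : |V| ≤ Real.sqrt ε * (1 + t + |r - t|) ^ (-(1 - d)) * (1 + |r - t|) ^ (-(1 + γ'))) :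
    ((1 + t) / ε) * U ^ 2 * V ^ 2 * w ≤
      (ε * (1 + t) ^ (4 * d - 1)) * (((1 + t + |r - t|) ^ 2)⁻¹ * (1 + (r - t) ^ 2)⁻¹) := by
  have hq := abs_nonneg (r - t)
  have hq2 := sq_abs (r - t)
  rw [← hq2]
  generalize |r - t| = q at *
  have hX : 0 < 1 + t + q := by linarith
  have hY : 0 < 1 + q := by linarith
  have ht1 : 0 < 1 + t := by linarith
  set B := Real.sqrt ε * (1 + t + q) ^ (-(1 - d)) * (1 + q) ^ (-(1 + γ')) with hB
  have hU2 : U ^ 2 ≤ B ^ 2 := by rw [← sq_abs U]; gcongr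
  have hV2 : V ^ 2 ≤ B ^ 2 := by rw [← sq_abs V]; gcongr
  have hB2 : B ^ 2 = ε * (1 + t + q) ^ (2 * d - 2) * (1 + q) ^ (-2 - 2 * γ') := by
    rw [hB, mul_pow, mul_pow, Real.sq_sqrt hε.le, ← Real.rpow_mul_natCast hX.le,
      ← Real.rpow_mul_natCast hY.le]
    congr 2 <;> [congr 1; skip] <;> push_cast <;> ring_nf
  have e1 : (1 + t + q) ^ (2 * d - 2) * (1 + t + q) ^ (2 * d - 2)
      ≤ (1 + t) ^ (4 * d - 2) * ((1 + t + q) ^ 2)⁻¹ := by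
    have : (1 + t + q) ^ (2 * d - 2) * (1 + t + q) ^ (2 * d - 2)
        = (1 + t + q) ^ (4 * d - 2) * ((1 + t + q) ^ 2)⁻¹ := by
      rw [← Real.rpow_natCast, ← Real.rpow_neg hX.le, ← Real.rpow_add hX, ← Real.rpow_add hX]
      congr 1; push_cast; ring
    rw [this]
    apply mul_le_mul_of_nonneg_right _ (by positivity)
    exact Real.rpow_le_rpow_of_nonpos ht1 (by linarith) (by linarith)
  have e2 : (1 + q) ^ (-2 - 2 * γ') * (1 + q) ^ (-2 - 2 * γ') * (1 + q) ^ (1 + 2 * γ)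
      ≤ (1 + q ^ 2)⁻¹ := by
    rw [← Real.rpow_add hY, ← Real.rpow_add hY]
    calc _ ≤ (1 + q) ^ (-2 : ℝ) := Real.rpow_le_rpow_of_exponent_le (by linarith) (by linarith)
      _ = ((1 + q) ^ 2)⁻¹ := by rw [Real.rpow_neg hY.le]; norm_num
      _ ≤ _ := by gcongr; nlinarith
  have e3 : (1 + t) * (1 + t) ^ (4 * d - 2) = (1 + t) ^ (4 * d - 1) := by
    have h := Real.rpow_add ht1 1 (4 * d - 2)
    rw [Real.rpow_one] at h
    rw [← h]
    congr 1; ring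
  calc ((1 + t) / ε) * U ^ 2 * V ^ 2 * w
      ≤ ((1 + t) / ε) * B ^ 2 * B ^ 2 * (1 + q) ^ (1 + 2 * γ) := by gcongr
    _ = ε * (1 + t) * ((1 + t + q) ^ (2 * d - 2) * (1 + t + q) ^ (2 * d - 2)) *
        ((1 + q) ^ (-2 - 2 * γ') * (1 + q) ^ (-2 - 2 * γ') * (1 + q) ^ (1 + 2 * γ)) := by
        rw [hB2]; field_simp
    _ ≤ ε * (1 + t) * ((1 + t) ^ (4 * d - 2) * ((1 + t + q) ^ 2)⁻¹) * (1 + q ^ 2)⁻¹ := by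
        gcongr
    _ = _ := by rw [← e3]; ring

theorem aux_rad_s14 (t : ℝ) (ht : 0 ≤ t) :
    IntegrableOn (fun r : ℝ => r ^ 2 * (((1 + t + |r - t|) ^ 2)⁻¹ * (1 + (r - t) ^ 2)⁻¹))
      (Set.Ioi 0) ∧
    ∫ r in Set.Ioi (0 : ℝ), r ^ 2 * (((1 + t + |r - t|) ^ 2)⁻¹ * (1 + (r - t) ^ 2)⁻¹)
      ≤ Real.pi := by
  have hI : Integrable (fun r : ℝ => (1 + (r - t) ^ 2)⁻¹) :=
    integrable_inv_one_add_sq.comp_sub_right t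
  have hb : ∀ r : ℝ, 0 < r → r ^ 2 * (((1 + t + |r - t|) ^ 2)⁻¹ * (1 + (r - t) ^ 2)⁻¹)
      ≤ (1 + (r - t) ^ 2)⁻¹ := by
    intro r hr
    have h1 := le_abs_self (r - t)
    have h2 := abs_nonneg (r - t)
    have : r ^ 2 * ((1 + t + |r - t|) ^ 2)⁻¹ ≤ 1 := by
      rw [← div_eq_mul_inv]
      apply div_le_one_of_le₀ _ (by positivity)
      gcongr; linarith
    rw [← mul_assoc]
    exact mul_le_of_le_one_left (by positivity) this
  have hint : IntegrableOn (fun r : ℝ => r ^ 2 * (((1 + t + |r - t|) ^ 2)⁻¹ * (1 + (r - t) ^ 2)⁻¹))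
      (Set.Ioi 0) := by
    refine Integrable.mono' hI.integrableOn (by fun_prop) ?_
    refine (ae_restrict_iff' measurableSet_Ioi).2 (Filter.Eventually.of_forall ?_)
    intro r hr
    rw [Real.norm_of_nonneg (by positivity)]
    exact hb r hr
  refine ⟨hint, ?_⟩
  calc _ ≤ ∫ r in Set.Ioi (0 : ℝ), (1 + (r - t) ^ 2)⁻¹ :=
        setIntegral_mono_on hint hI.integrableOn measurableSet_Ioi hb
    _ ≤ ∫ r : ℝ, (1 + (r - t) ^ 2)⁻¹ :=
        setIntegral_le_integral hI (Filter.Eventually.of_forall fun r => by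
          simp only [Pi.zero_apply]; positivity)
    _ = Real.pi := by
        rw [integral_sub_right_eq_self (fun r : ℝ => (1 + r ^ 2)⁻¹) t]
        exact integral_univ_inv_one_add_sq

theorem aux_space (t : ℝ) (ht : 0 ≤ t) :
    Integrable (fun x : EuclideanSpace ℝ (Fin 3) =>
      ((1 + t + |‖x‖ - t|) ^ 2)⁻¹ * (1 + (‖x‖ - t) ^ 2)⁻¹) ∧
    ∫ x : EuclideanSpace ℝ (Fin 3), ((1 + t + |‖x‖ - t|) ^ 2)⁻¹ * (1 + (‖x‖ - t) ^ 2)⁻¹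
      ≤ 3 * (volume.real (Metric.ball (0 : EuclideanSpace ℝ (Fin 3)) 1) * Real.pi) := by
  obtain ⟨h1, h2⟩ := aux_rad_s14 t ht
  constructor
  · rw [integrable_fun_norm_addHaar (volume : Measure (EuclideanSpace ℝ (Fin 3)))
      (f := fun r : ℝ => ((1 + t + |r - t|) ^ 2)⁻¹ * (1 + (r - t) ^ 2)⁻¹)]
    simpa using h1
  · rw [integral_fun_norm_addHaar (volume : Measure (EuclideanSpace ℝ (Fin 3)))
      (fun r : ℝ => ((1 + t + |r - t|) ^ 2)⁻¹ * (1 + (r - t) ^ 2)⁻¹)]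
    simp only [finrank_euclideanSpace, Fintype.card_fin, smul_eq_mul, nsmul_eq_mul]
    push_cast
    gcongr

theorem aux_time (a T : ℝ) (ha : 0 < a) (hT : 0 ≤ T) :
    IntegrableOn (fun t : ℝ => (1 + t) ^ (a - 1)) (Set.Icc 0 T) ∧
    ∫ t in Set.Icc (0 : ℝ) T, (1 + t) ^ (a - 1) = ((1 + T) ^ a - 1) / a := by
  have hc : ContinuousOn (fun t : ℝ => (1 + t) ^ (a - 1)) (Set.Icc 0 T) := by
    refine ContinuousOn.rpow_const (by fun_prop) ?_
    intro x hx; left; have := hx.1; linarith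
  refine ⟨hc.integrableOn_Icc, ?_⟩
  rw [integral_Icc_eq_integral_Ioc, ← intervalIntegral.integral_of_le hT,
    intervalIntegral.integral_eq_sub_of_hasDerivAt (f := fun t : ℝ => (1 + t) ^ a / a)]
  · simp; ring
  · intro x hx
    rw [Set.uIcc_of_le hT] at hx
    have hx0 := hx.1
    have := (((hasDerivAt_id x).const_add 1).rpow_const (p := a)
      (Or.inl (by simp only [id]; linarith))).div_const a
    refine HasDerivAt.congr_deriv this ?_
    simp only [id]
    field_simp
  · apply ContinuousOn.intervalIntegrable
    rwa [Set.uIcc_of_le hT]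

/-- **Control of the non-linearity `∂Φ·∂Φ` (core of the second estimate of Lemma 4.4).**
Let `γ > 0`, `γ' > γ − 1/2` with `γ' > 0`, and `c > 0`.  There is `C > 0`, depending only
on `γ`, `γ'` and `c`, such that for every `ε ∈ (0,1]` with `c ε ≤ 1/4`, every `T ≥ 0` and
all measurable `u, v` with `|u(t,x)|, |v(t,x)| ≤ √ε (1+t+|q|)^(−(1−cε)) (1+|q|)^(−(1+γ'))`,
where `q = |x| − t`, one has
`∫₀^T ∫_{ℝ³} ((1+t)/ε) u² v² w_γ(q) dx dt ≤ C ((1+T)^(4cε) − 1)`. -/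
theorem nonlinearity_dphi_dphi_estimate
    (γ γ' c : ℝ) (hγ : 0 < γ) (hγ' : γ - 1 / 2 < γ') (hγ'0 : 0 < γ') (hc : 0 < c) :
    ∃ C > (0 : ℝ), ∀ ε : ℝ, 0 < ε → ε ≤ 1 → c * ε ≤ 1 / 4 → ∀ T : ℝ, 0 ≤ T →
      ∀ u v : ℝ × EuclideanSpace ℝ (Fin 3) → ℝ, Measurable u → Measurable v →
      (∀ t ∈ Set.Icc (0 : ℝ) T, ∀ x : EuclideanSpace ℝ (Fin 3),
        |u (t, x)| ≤ Real.sqrt ε * (1 + t + |‖x‖ - t|) ^ (-(1 - c * ε))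
          * (1 + |‖x‖ - t|) ^ (-(1 + γ'))) →
      (∀ t ∈ Set.Icc (0 : ℝ) T, ∀ x : EuclideanSpace ℝ (Fin 3),
        |v (t, x)| ≤ Real.sqrt ε * (1 + t + |‖x‖ - t|) ^ (-(1 - c * ε))
          * (1 + |‖x‖ - t|) ^ (-(1 + γ'))) →
      (∫ t in Set.Icc (0 : ℝ) T, ∫ x : EuclideanSpace ℝ (Fin 3),
          ((1 + t) / ε) * u (t, x) ^ 2 * v (t, x) ^ 2 * wWeight γ (‖x‖ - t))
        ≤ C * ((1 + T) ^ (4 * c * ε) - 1) := by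
  set K : ℝ := 3 * (volume.real (Metric.ball (0 : EuclideanSpace ℝ (Fin 3)) 1) * Real.pi) with hK
  have hK0 : 0 ≤ K := by positivity
  refine ⟨(K + 1) / (4 * c), by positivity, ?_⟩
  intro ε hε hε1 hcε T hT u v hum hvm hu hv
  have hw0 : ∀ q, 0 ≤ wWeight γ q := by
    intro q; unfold wWeight; split_ifs <;> positivity
  have hw1 : ∀ q, wWeight γ q ≤ (1 + |q|) ^ (1 + 2 * γ) := by
    intro q; unfold wWeight; split_ifs
    · exact le_rfl
    · exact Real.one_le_rpow (by linarith [abs_nonneg q]) (by linarith)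
  have ha : 0 < 4 * (c * ε) := by positivity
  obtain ⟨hti, hte⟩ := aux_time (4 * (c * ε)) T ha hT
  have hnn : ∀ t ∈ Set.Icc (0 : ℝ) T, ∀ x : EuclideanSpace ℝ (Fin 3),
      0 ≤ ((1 + t) / ε) * u (t, x) ^ 2 * v (t, x) ^ 2 * wWeight γ (‖x‖ - t) := by
    intro t ht x
    have := ht.1
    have := hw0 (‖x‖ - t)
    positivity
  have hinner : ∀ t ∈ Set.Icc (0 : ℝ) T, (∫ x : EuclideanSpace ℝ (Fin 3),
      ((1 + t) / ε) * u (t, x) ^ 2 * v (t, x) ^ 2 * wWeight γ (‖x‖ - t))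
        ≤ (ε * K) * (1 + t) ^ (4 * (c * ε) - 1) := by
    intro t ht
    have ht0 := ht.1
    obtain ⟨hsi, hsl⟩ := aux_space t ht0
    calc _ ≤ ∫ x : EuclideanSpace ℝ (Fin 3), (ε * (1 + t) ^ (4 * (c * ε) - 1)) *
          (((1 + t + |‖x‖ - t|) ^ 2)⁻¹ * (1 + (‖x‖ - t) ^ 2)⁻¹) := by
          refine integral_mono_of_nonneg (Filter.Eventually.of_forall (hnn t ht))
            (hsi.const_mul _) (Filter.Eventually.of_forall fun x => ?_)
          exact aux_pt γ γ' (c * ε) ε t ‖x‖ _ _ _ hγ' hγ'0 hε hcε ht0 (hw0 _) (hw1 _)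
            (hu t ht x) (hv t ht x)
      _ ≤ (ε * (1 + t) ^ (4 * (c * ε) - 1)) * K := by
          rw [integral_const_mul]
          gcongr
      _ = _ := by ring
  calc _ ≤ ∫ t in Set.Icc (0 : ℝ) T, (ε * K) * (1 + t) ^ (4 * (c * ε) - 1) := by
        refine integral_mono_of_nonneg ?_ (hti.const_mul _) ?_
        · exact (ae_restrict_iff' measurableSet_Icc).2 (Filter.Eventually.of_forall
            fun t ht => integral_nonneg (hnn t ht))
        · exact (ae_restrict_iff' measurableSet_Icc).2 (Filter.Eventually.of_forall hinner)
    _ = K / (4 * c) * ((1 + T) ^ (4 * (c * ε)) - 1) := by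
        rw [integral_const_mul, hte]; field_simp
    _ ≤ _ := by
        rw [← mul_assoc]
        have : 1 ≤ (1 + T) ^ (4 * c * ε) :=
          Real.one_le_rpow (by linarith) (by rw [mul_assoc]; exact ha.le)
        have h2 : 0 ≤ (1 + T) ^ (4 * c * ε) - 1 := by linarith
        gcongr
        linarith

end
end
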